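/- Let d ≥ 2 and let m₀ ≥ m₁ ≥ ⋯ ≥ m_r ≥ 0 be integers satisfying Σᵢ mᵢ = 3(d − 1) and Σᵢ mᵢ² = d² − 1 (the homaloidal conditions, with r ≥ 2). Then m₀ + m₁ + m₂ > d (Noether's inequality). -/

import Mathlib

/-- Noether's inequality: if `m₀ ≥ m₁ ≥ ⋯ ≥ m_r ≥ 0` satisfy the homaloidal conditions
`∑ mᵢ = 3(d−1)` and `∑ mᵢ² = d² − 1` with `d ≥ 2` and `r ≥ 2`, then `m₀ + m₁ + m₂ > d`. -/
theorem stmt_10 (d r : ℕ) (hd : 2 ≤ d) (hr : 2 ≤ r)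
    (m : Fin (r + 1) → ℕ)
    (hmono : ∀ i j : Fin (r + 1), i ≤ j → m j ≤ m i)
    (h1 : ∑ i, m i = 3 * (d - 1))
    (h2 : ∑ i, (m i) ^ 2 = d ^ 2 - 1) :
    d < m ⟨0, by omega⟩ + m ⟨1, by omega⟩ + m ⟨2, by omega⟩ := by
  obtain ⟨k, rfl⟩ := Nat.exists_eq_add_of_le' hr
  obtain ⟨e, rfl⟩ := Nat.exists_eq_add_of_le' (show 1 ≤ d by omega)
  have e0 : (⟨0, by omega⟩ : Fin (k + 2 + 1)) = 0 := rfl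
  have e1 : (⟨1, by omega⟩ : Fin (k + 2 + 1)) = Fin.succ 0 := rfl
  have e2 : (⟨2, by omega⟩ : Fin (k + 2 + 1)) = Fin.succ (Fin.succ 0) := rfl
  rw [e0, e1, e2]
  have h01 : m (Fin.succ 0) ≤ m 0 := hmono _ _ (Fin.zero_le _)
  have h12 : m (Fin.succ (Fin.succ 0)) ≤ m (Fin.succ 0) :=
    hmono _ _ (Fin.succ_le_succ_iff.2 (Fin.zero_le _))
  have hS : ∑ i : Fin k, m i.succ.succ.succ ^ 2
      ≤ m (Fin.succ (Fin.succ 0)) * ∑ i : Fin k, m i.succ.succ.succ := by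
    rw [Finset.mul_sum]
    refine Finset.sum_le_sum fun i _ => ?_
    rw [sq]
    exact Nat.mul_le_mul_right _ (hmono _ _ (Fin.succ_le_succ_iff.2
      (Fin.succ_le_succ_iff.2 (Fin.zero_le _))))
  rw [Fin.sum_univ_succ, Fin.sum_univ_succ, Fin.sum_univ_succ] at h1 h2
  have h3 : (e + 1) ^ 2 - 1 = e * (e + 2) := by
    rw [show (e + 1) ^ 2 = e * (e + 2) + 1 by ring]; rfl
  rw [h3] at h2
  rw [Nat.add_sub_cancel] at h1
  generalize m 0 = a at *
  generalize m (Fin.succ 0) = b at *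
  generalize m (Fin.succ (Fin.succ 0)) = c at *
  generalize ∑ i : Fin k, m i.succ.succ.succ ^ 2 = Q at *
  generalize ∑ i : Fin k, m i.succ.succ.succ = P at *
  have ha : a ≤ e := by
    by_contra h
    push Not at h
    nlinarith
  have he : 1 ≤ e := by omega
  clear hmono e0 e1 e2 h3
  zify at *
  by_contra h
  push Not at h
  have hP : (P : ℤ) = 3 * e - a - b - c := by linarith
  have hQ : (Q : ℤ) = e * (e + 2) - a ^ 2 - b ^ 2 - c ^ 2 := by linarith
  rw [hP, hQ] at hS
  have t1 : (0 : ℤ) ≤ (e - a) * (a - c) := mul_nonneg (by linarith) (by linarith)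
  have t2 : (0 : ℤ) ≤ (e - b) * (b - c) := mul_nonneg (by linarith) (by linarith)
  have t3 : (0 : ℤ) ≤ e * (e + 1 - (a + b + c)) := mul_nonneg (by linarith) (by linarith)
  nlinarith
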